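/- Let S be an antipodal point set of 2n points on the unit circle and let q₁, …, q_m (4 ≤ m < n) be consecutive points of S in circular order. Suppose the antipodal polygon P contains q₁ and q₂ as vertices, contains either both of q_{m-1}, q_m or neither of them, and the points q₂, …, q_{m-1} alternate between being vertices of P and not. Let P' be obtained from P by flipping each of q₂, …, q_{m-1} (replacing each chosen point by its antipode in the selection). Then Area(P') > Area(P). -/

import Mathlib

open MeasureTheory

/-- The point on the unit circle at angle `θ`. -/
noncomputable def pt (θ : ℝ) : ℝ × ℝ := (Real.cos θ, Real.sin θ)

/-- Standard dot product in the plane. -/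
noncomputable def dotp (v w : ℝ × ℝ) : ℝ := v.1 * w.1 + v.2 * w.2

/-- Given angles `θ : Fin n → ℝ` (determining the antipodal point set
`{pt (θ i)} ∪ {-pt (θ i)}`) and a selection `ε`, the `i`-th vertex of the
corresponding antipodal polygon: `pt (θ i)` if `ε i` and `-pt (θ i)` otherwise. -/
noncomputable def vtx {n : ℕ} (θ : Fin n → ℝ) (ε : Fin n → Bool) (i : Fin n) : ℝ × ℝ :=
  if ε i then pt (θ i) else -pt (θ i)

/-- The antipodal polygon determined by the selection `ε`. -/
noncomputable def apoly {n : ℕ} (θ : Fin n → ℝ) (ε : Fin n → Bool) : Set (ℝ × ℝ) :=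
  convexHull ℝ (Set.range (vtx θ ε))

/-- The antipodal polygon is thin: all vertices lie in a closed half-plane
bounded by a line through the origin. -/
def Thin {n : ℕ} (θ : Fin n → ℝ) (ε : Fin n → Bool) : Prop :=
  ∃ v : ℝ × ℝ, v ≠ 0 ∧ ∀ i, 0 ≤ dotp v (vtx θ ε i)

/-- The antipodal polygon is thick: every open half-plane bounded by a line
through the origin contains at least `⌈(n-2)/2⌉ = (n-1)/2` of its vertices. -/
def Thick {n : ℕ} (θ : Fin n → ℝ) (ε : Fin n → Bool) : Prop :=
  ∀ v : ℝ × ℝ, v ≠ 0 →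
    (n - 1) / 2 ≤ Set.ncard {i : Fin n | 0 < dotp v (vtx θ ε i)}

/-- The `j`-th point (indices mod `2*n`) of the antipodal point set in circular
order `pt (θ 0), …, pt (θ (n-1)), -pt (θ 0), …, -pt (θ (n-1))`. -/
noncomputable def spt {n : ℕ} (θ : Fin n → ℝ) (j : ℕ) : ℝ × ℝ :=
  if h : j % (2 * n) < n then pt (θ ⟨j % (2 * n), h⟩)
  else if h2 : j % (2 * n) - n < n then -pt (θ ⟨j % (2 * n) - n, h2⟩) else 0

/-- Whether the `j`-th point (indices mod `2*n`) of the antipodal point set, in the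
circular order `pt (θ 0), …, pt (θ (n-1)), -pt (θ 0), …, -pt (θ (n-1))`,
is a vertex of the antipodal polygon selected by `ε`. -/
def chosen {n : ℕ} (ε : Fin n → Bool) (j : ℕ) : Bool :=
  if h : j % (2 * n) < n then ε ⟨j % (2 * n), h⟩
  else if h2 : j % (2 * n) - n < n then !(ε ⟨j % (2 * n) - n, h2⟩) else false

open Real

lemma sin_add_sin_sub_eq (p q x y : ℝ) :
    sin (q - x) + sin (q - y) - (sin (p - x) + sin (p - y)) =
      4 * sin ((q - p) / 2) * cos ((p + q - x - y) / 2) * cos ((x - y) / 2) := by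
  have e1 : sin (q - x) + sin (q - y) = 2 * sin (q - (x + y) / 2) * cos ((x - y) / 2) := by
    rw [show q - x = (q - (x + y) / 2) - (x - y) / 2 by ring,
      show q - y = (q - (x + y) / 2) + (x - y) / 2 by ring, sin_sub, sin_add]; ring
  have e2 : sin (p - x) + sin (p - y) = 2 * sin (p - (x + y) / 2) * cos ((x - y) / 2) := by
    rw [show p - x = (p - (x + y) / 2) - (x - y) / 2 by ring,
      show p - y = (p - (x + y) / 2) + (x - y) / 2 by ring, sin_sub, sin_add]; ring
  have e3 : sin (q - (x + y) / 2) - sin (p - (x + y) / 2) =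
      2 * sin ((q - p) / 2) * cos ((p + q - x - y) / 2) := by
    rw [show q - (x + y) / 2 = (p + q - x - y) / 2 + (q - p) / 2 by ring,
      show p - (x + y) / 2 = (p + q - x - y) / 2 - (q - p) / 2 by ring, sin_sub, sin_add]; ring
  rw [e1, e2]
  linear_combination 2 * cos ((x - y) / 2) * e3

lemma sin_add_sin_lt {p q x y : ℝ} (hpq : p < q) (hpq' : q < p + 2 * π)
    (hxy : |x - y| < π) (hs : |p + q - x - y| < π) :
    sin (p - x) + sin (p - y) < sin (q - x) + sin (q - y) := by
  rw [abs_lt] at hxy hs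
  have h1 : 0 < sin ((q - p) / 2) := sin_pos_of_pos_of_lt_pi (by linarith) (by linarith)
  have h2 : 0 < cos ((p + q - x - y) / 2) := cos_pos_of_mem_Ioo ⟨by linarith, by linarith⟩
  have h3 : 0 < cos ((x - y) / 2) := cos_pos_of_mem_Ioo ⟨by linarith, by linarith⟩
  have := sin_add_sin_sub_eq p q x y
  have : 0 < 4 * sin ((q - p) / 2) * cos ((p + q - x - y) / 2) * cos ((x - y) / 2) := by positivity
  linarith

lemma neg_cos_lt_cos {x y : ℝ} (hx : 0 ≤ x) (hy : 0 ≤ y) (h : x + y < π) : -cos x < cos y := by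
  rw [← cos_pi_sub]
  exact cos_lt_cos_of_nonneg_of_le_pi hy (by linarith) (by linarith)

lemma weighted_sum_pos {u v w x y z : ℝ} (hu : 0 < u) (hv : 0 < v) (hw : 0 < w)
    (huv : u ≤ v + w) (hxy : -x < y) (hxz : -x < z) (hyz : -y < z) (hvw : v ≤ u + w)
    (hwu : w ≤ u + v) : 0 < u * x + v * y + w * z := by
  rcases lt_or_ge x 0 with hx | hx
  · nlinarith [mul_pos hv (sub_pos.2 hxy), mul_pos hw (sub_pos.2 hxz)]
  rcases lt_or_ge y 0 with hy | hy
  · nlinarith [mul_pos hu (sub_pos.2 hxy), mul_pos hw (sub_pos.2 hyz)]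
  rcases lt_or_ge z 0 with hz | hz
  · nlinarith [mul_pos hu (sub_pos.2 hxz), mul_pos hv (sub_pos.2 hyz)]
  rcases hx.eq_or_lt with h | h
  · have : 0 < y := by linarith
    positivity
  · positivity

lemma sin_add_sin_add_sin_lt {a b c d e : ℝ} (ha : 0 < a) (hb : 0 < b) (hc : 0 ≤ b + c)
    (hc' : 0 ≤ c + d) (hd : 0 < d) (he : 0 < e) (hs : a + b + c + d + e < π) :
    sin a + sin c + sin e < sin (a + b) + sin (b + c + d) + sin (d + e) := by
  have e1 : sin (a + b) - sin a = 2 * sin (b / 2) * cos (a + b / 2) := by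
    rw [show a + b = (a + b / 2) + b / 2 by ring]
    nth_rw 2 [show a = (a + b / 2) - b / 2 by ring]
    rw [sin_sub, sin_add]; ring
  have e2 : sin (d + e) - sin e = 2 * sin (d / 2) * cos (e + d / 2) := by
    rw [show d + e = (e + d / 2) + d / 2 by ring]
    nth_rw 2 [show e = (e + d / 2) - d / 2 by ring]
    rw [sin_sub, sin_add]; ring
  have e3 : sin (b + c + d) - sin c = 2 * sin ((b + d) / 2) * cos (c + (b + d) / 2) := by
    rw [show b + c + d = (c + (b + d) / 2) + (b + d) / 2 by ring]
    nth_rw 2 [show c = (c + (b + d) / 2) - (b + d) / 2 by ring]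
    rw [sin_sub, sin_add]; ring
  have pos : ∀ x, 0 < x → x < π → 0 < sin x := fun x h h' => sin_pos_of_pos_of_lt_pi h h'
  have hb' := pos (b / 2) (by linarith) (by linarith)
  have hd' := pos (d / 2) (by linarith) (by linarith)
  have hbd' := pos ((b + d) / 2) (by linarith) (by linarith)
  have tri : ∀ x y, 0 ≤ sin x → 0 ≤ sin y → sin (x + y) ≤ sin x + sin y := fun x y hx hy => by
    rw [sin_add]
    nlinarith [cos_le_one x, cos_le_one y]
  have tri' : ∀ x y, 0 ≤ sin x → 0 ≤ sin y → sin (x - y) ≤ sin x + sin y := fun x y hx hy => by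
    rw [sin_sub]
    nlinarith [cos_le_one y, neg_one_le_cos x]
  have t1 := tri (b / 2) (d / 2) hb'.le hd'.le
  have t2 := tri' ((b + d) / 2) (b / 2) hbd'.le hb'.le
  have t3 := tri' ((b + d) / 2) (d / 2) hbd'.le hd'.le
  rw [show b / 2 + d / 2 = (b + d) / 2 by ring] at t1
  rw [show (b + d) / 2 - b / 2 = d / 2 by ring] at t2
  rw [show (b + d) / 2 - d / 2 = b / 2 by ring] at t3
  have := weighted_sum_pos hb' hd' hbd' (by linarith)
    (neg_cos_lt_cos (x := a + b / 2) (y := e + d / 2) (by linarith) (by linarith) (by linarith))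
    (neg_cos_lt_cos (x := a + b / 2) (y := c + (b + d) / 2) (by linarith) (by linarith)
      (by linarith))
    (neg_cos_lt_cos (by linarith) (by linarith) (by linarith)) (by linarith) t1
  linarith

/-- The largest index at most `t` selected by `w`, or `0` if there is none. -/
def lastSel (w : ℕ → Bool) : ℕ → ℕ
  | 0 => 0
  | t + 1 => if w (t + 1) then t + 1 else lastSel w t

/-- Twice the signed area swept from the origin along the polygonal path through the points at
angles `φ i` selected by `w`, up to index `t`. -/
noncomputable def sweep (φ : ℕ → ℝ) (w : ℕ → Bool) (t : ℕ) : ℝ :=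
  ∑ i ∈ Finset.range t, sin (φ (lastSel w (i + 1)) - φ (lastSel w i))

section Selection

variable {φ : ℕ → ℝ} {w w' : ℕ → Bool} {n : ℕ}

lemma lastSel_of_true {t : ℕ} (h : w t = true) : lastSel w t = t := by
  cases t <;> simp [lastSel, h]

lemma lastSel_succ_of_false {t : ℕ} (h : w (t + 1) = false) :
    lastSel w (t + 1) = lastSel w t := by
  simp [lastSel, h]

lemma lastSel_le (t : ℕ) : lastSel w t ≤ t := by
  induction t with
  | zero => simp [lastSel]
  | succ t ih => simp only [lastSel]; split <;> omega

lemma lastSel_mono : Monotone (lastSel w) := by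
  refine monotone_nat_of_le_succ fun t => ?_
  have := lastSel_le (w := w) t
  simp only [lastSel]; split <;> omega

lemma lastSel_sel (h0 : w 0 = true) (t : ℕ) : w (lastSel w t) = true := by
  induction t with
  | zero => simpa [lastSel]
  | succ t ih => simp only [lastSel]; split <;> assumption

lemma sweep_succ_of_true {t : ℕ} (h : w (t + 1) = true) :
    sweep φ w (t + 1) = sweep φ w t + sin (φ (t + 1) - φ (lastSel w t)) := by
  rw [sweep, Finset.sum_range_succ, lastSel_of_true h]; rfl

lemma sweep_succ_of_false {t : ℕ} (h : w (t + 1) = false) :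
    sweep φ w (t + 1) = sweep φ w t := by
  rw [sweep, Finset.sum_range_succ, lastSel_succ_of_false h]; simp [sweep]

/-- Along a stretch where two selections agree, either nothing is selected or the two sweeps differ
only in the edge leading to the first selected index. -/
lemma sweep_of_agree (u k : ℕ) (h : ∀ t, u < t → t ≤ u + k → w' t = w t) :
    (lastSel w (u + k) = lastSel w u ∧ lastSel w' (u + k) = lastSel w' u ∧
      sweep φ w (u + k) = sweep φ w u ∧ sweep φ w' (u + k) = sweep φ w' u ∧
      ∀ t, u < t → t ≤ u + k → w t = false) ∨
    ∃ b a, u < b ∧ b ≤ a ∧ a ≤ u + k ∧ lastSel w (u + k) = a ∧ lastSel w' (u + k) = a ∧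
      sweep φ w (u + k) - sweep φ w' (u + k) = sweep φ w u - sweep φ w' u +
        sin (φ b - φ (lastSel w u)) - sin (φ b - φ (lastSel w' u)) := by
  induction k with
  | zero => left; exact ⟨rfl, rfl, rfl, rfl, fun t h1 h2 => by omega⟩
  | succ k ih =>
    have hk := h (u + k + 1) (by omega) (by omega)
    rw [← add_assoc]
    rcases hwk : w (u + k + 1) with _ | _ <;> rw [hwk] at hk
    · rw [lastSel_succ_of_false hwk, lastSel_succ_of_false hk, sweep_succ_of_false hwk,
        sweep_succ_of_false hk]
      rcases ih fun t h1 h2 => h t h1 (by omega) with ⟨h1, h2, h3, h4, h5⟩ | ⟨b, a, h1, h2, h3, h4⟩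
      · refine Or.inl ⟨h1, h2, h3, h4, fun t ht ht' => ?_⟩
        rcases ht'.eq_or_lt with rfl | h'
        · exact hwk
        · exact h5 t ht (by omega)
      · exact Or.inr ⟨b, a, h1, h2, by omega, h4⟩
    · rw [lastSel_of_true hwk, lastSel_of_true hk, sweep_succ_of_true hwk, sweep_succ_of_true hk]
      right
      rcases ih fun t h1 h2 => h t h1 (by omega) with ⟨h1, h2, h3, h4, h5⟩ |
        ⟨b, a, h1, h2, h3, h4, h5, h6⟩
      · exact ⟨_, _, by omega, le_rfl, le_rfl, rfl, rfl, by rw [h1, h2, h3, h4]; ring⟩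
      · exact ⟨b, _, h1, by omega, le_rfl, rfl, rfl, by rw [h4, h5]; linarith⟩

lemma sweep_sub_of_lastSel_eq (u k : ℕ) (h : ∀ t, u < t → t ≤ u + k → w' t = w t)
    (hu : lastSel w u = lastSel w' u) :
    lastSel w (u + k) = lastSel w' (u + k) ∧
      sweep φ w (u + k) - sweep φ w' (u + k) = sweep φ w u - sweep φ w' u := by
  rcases sweep_of_agree (φ := φ) u k h with ⟨h1, h2, h3, h4, -⟩ | ⟨b, a, -, -, -, h1, h2, h3⟩
  · rw [h1, h2, h3, h4]; exact ⟨hu, rfl⟩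
  · rw [h1, h2, h3, hu]; exact ⟨rfl, by ring⟩

/-- Comparison of the two sweeps along an alternating run and its antipodal copy. -/
lemma sweep_of_alternating (hper : ∀ t, φ (t + n) = φ t + π)
    (hw : ∀ t, w (t + n) = !w t) (hw' : ∀ t, w' (t + n) = !w' t)
    (h0 : w 0 = true) (h1 : w 1 = true) (h0' : w' 0 = true) (s : ℕ) (hs : 1 ≤ s)
    (halt : ∀ t, 1 ≤ t → t ≤ s → w t ≠ w (t + 1))
    (hflip : ∀ t, 1 ≤ t → t ≤ s + 1 → w' t = !w t) :
    (if w (s + 1) then lastSel w (s + 1) = s + 1 ∧ lastSel w' (s + 1) = s ∧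
      lastSel w (n + s + 1) = s + n ∧ lastSel w' (n + s + 1) = s + 1 + n else
      lastSel w (s + 1) = s ∧ lastSel w' (s + 1) = s + 1 ∧
      lastSel w (n + s + 1) = s + 1 + n ∧ lastSel w' (n + s + 1) = s + n) ∧
    sweep φ w (s + 1) - sweep φ w' (s + 1) +
      (sweep φ w (n + s + 1) - sweep φ w' (n + s + 1)) =
      (sweep φ w n - sweep φ w' n) +
      (sin (φ 1 - φ 0) - sin (φ 2 - φ 0) + sin (φ (2 + n) - φ (lastSel w n)) -
        sin (φ (1 + n) - φ (lastSel w' n))) := by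
  induction s, hs using Nat.le_induction with
  | base =>
    have w2 : w 2 = false := by simpa [h1] using halt 1 le_rfl le_rfl
    have w1' : w' 1 = false := by simpa [h1] using hflip 1 le_rfl (by omega)
    have w2' : w' 2 = true := by simpa [w2] using hflip 2 (by omega) (by omega)
    have wn1 : w (n + 1) = false := by simpa [add_comm, h1] using hw 1
    have wn2 : w (n + 1 + 1) = true := by
      rw [show n + 1 + 1 = 2 + n by ring, hw, w2]; rfl
    have wn1' : w' (n + 1) = true := by simpa [add_comm, w1'] using hw' 1
    have wn2' : w' (n + 1 + 1) = false := by
      rw [show n + 1 + 1 = 2 + n by ring, hw', w2']; rfl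
    rw [if_neg (by simp [w2]), lastSel_succ_of_false w2, lastSel_of_true h1, lastSel_of_true w2',
      lastSel_of_true wn2, lastSel_succ_of_false wn2', lastSel_of_true wn1',
      sweep_succ_of_false w2, sweep_succ_of_true w2', sweep_succ_of_true wn2,
      sweep_succ_of_false wn2', sweep_succ_of_true wn1', sweep_succ_of_false wn1,
      lastSel_succ_of_false wn1, sweep_succ_of_true (t := 0) h1,
      sweep_succ_of_false (t := 0) w1', lastSel_succ_of_false (t := 0) w1', lastSel_of_true h0,
      lastSel_of_true h0']
    refine ⟨by omega, ?_⟩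
    rw [show n + 1 + 1 = 2 + n by ring, show n + 1 = 1 + n by ring]
    simp [sweep]
    ring
  | succ s hs ih =>
    obtain ⟨ih1, ih2⟩ := ih (fun t h h' => halt t h (by omega)) fun t h h' => hflip t h (by omega)
    have a1 := halt (s + 1) (by omega) le_rfl
    have a2 := hflip (s + 1 + 1) (by omega) (by omega)
    have a3 : w (n + (s + 1) + 1) = !w (s + 1 + 1) := by rw [← hw]; congr 1; ring
    have a4 : w' (n + (s + 1) + 1) = !w' (s + 1 + 1) := by rw [← hw']; congr 1; ring
    have e : n + s + 1 = n + (s + 1) := by ring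
    have p1 := hper (s + 1 + 1)
    have p2 := hper s
    have e2 : n + (s + 1) + 1 = s + 1 + 1 + n := by ring
    rw [e] at ih1 ih2
    rcases hws : w (s + 1 + 1) with _ | _
    · have b1 : w (s + 1) = true := by simpa [hws] using a1
      rw [hws] at a2 a3
      rw [a2] at a4
      simp only [Bool.not_false, Bool.not_true] at a2 a3 a4
      rw [if_pos b1] at ih1
      obtain ⟨c1, c2, c3, c4⟩ := ih1
      rw [if_neg (by simp), lastSel_succ_of_false hws, lastSel_of_true a2, lastSel_of_true a3,
        lastSel_succ_of_false a4, sweep_succ_of_false hws, sweep_succ_of_true a2,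
        sweep_succ_of_true a3, sweep_succ_of_false a4, c1, c2, c3, c4]
      refine ⟨by omega, ?_⟩
      rw [e2, p1, p2, ← ih2]
      ring_nf
    · have b1 : w (s + 1) = false := by simpa [hws] using a1
      rw [hws] at a2 a3
      rw [a2] at a4
      simp only [Bool.not_false, Bool.not_true] at a2 a3 a4
      rw [if_neg (by simp [b1])] at ih1
      obtain ⟨c1, c2, c3, c4⟩ := ih1
      rw [if_pos rfl, lastSel_succ_of_false a2, lastSel_of_true hws, lastSel_of_true a4,
        lastSel_succ_of_false a3, sweep_succ_of_false a2, sweep_succ_of_true hws,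
        sweep_succ_of_true a4, sweep_succ_of_false a3, c1, c2, c3, c4]
      refine ⟨by omega, ?_⟩
      rw [e2, p1, p2, ← ih2]
      ring_nf

theorem sweep_lt_sweep (hφ : StrictMono φ) (hper : ∀ t, φ (t + n) = φ t + π)
    (hw : ∀ t, w (t + n) = !w t) (hw' : ∀ t, w' (t + n) = !w' t)
    (h0 : w 0 = true) (h1 : w 1 = true) (s : ℕ) (hs : 1 ≤ s) (hsn : s + 3 < n)
    (hend : w (s + 1) = w (s + 2))
    (halt : ∀ t, 1 ≤ t → t ≤ s → w t ≠ w (t + 1))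
    (hflip : ∀ t, 1 ≤ t → t ≤ s + 1 → w' t = !w t)
    (hkeep : ∀ t, s + 2 ≤ t → t < n → w' t = w t) (hkeep0 : w' 0 = w 0) :
    sweep φ w (2 * n) < sweep φ w' (2 * n) := by
  have h0' : w' 0 = true := hkeep0.trans h0
  obtain ⟨hl, hsw⟩ := sweep_of_alternating hper hw hw' h0 h1 h0' s hs halt hflip
  have hpos := Real.pi_pos
  have wn : w n = false := by simpa [h0] using hw 0
  have wn' : w' n = false := by simpa [h0'] using hw' 0
  have ag1 : ∀ t, s + 2 < t → t ≤ s + 2 + (n - (s + 2)) → w' t = w t := fun t h h' => by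
    rcases (show t ≤ n by omega).eq_or_lt with rfl | h''
    · rw [wn, wn']
    · exact hkeep t (by omega) h''
  have ag2 : ∀ t, n + s + 1 + 1 < t → t ≤ n + s + 1 + 1 + (n - (s + 2)) → w' t = w t :=
    fun t h h' => by
      obtain ⟨t, rfl⟩ := Nat.exists_eq_add_of_le' (show n ≤ t by omega)
      rw [hw, hw', ag1 t (by omega) (by omega)]
  have w2n : w (2 * n) = true := by rw [two_mul, hw, wn]; rfl
  have e1 : s + 2 + (n - (s + 2)) = n := by omega
  have e2 : n + s + 1 + 1 + (n - (s + 2)) = 2 * n := by omega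
  have ws2' : w' (s + 1 + 1) = w (s + 2) := hkeep _ (by omega) (by omega)
  have wn2 : w (n + s + 1 + 1) = !w (s + 2) := by rw [← hw]; congr 1; ring
  have wn2' : w' (n + s + 1 + 1) = !w (s + 2) := by rw [← ws2', ← hw']; congr 1; ring
  have i01 := hφ (show 0 < 1 by omega)
  have i12 := hφ (show 1 < 2 by omega)
  have i2n := hφ (show s + 2 < n by omega)
  have p0 := hper 0
  have ps := hper s
  have ps1 := hper (s + 1)
  have ps2 := hper (s + 2)
  have p1 := hper 1
  have p2 := hper 2
  rw [zero_add] at p0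
  have j1 := hφ (show s < s + 1 by omega)
  have j2 := hφ (show s + 1 < s + 2 by omega)
  have j3 := hφ.monotone (show 1 ≤ s by omega)
  have j4 := hφ.monotone (show 2 ≤ s + 1 by omega)
  have j5 := hφ.monotone (show 2 ≤ s + 2 by omega)
  have flip_sin : ∀ x y, sin (x + π - y) = sin (y - x) := fun x y => by
    rw [show x + π - y = π - (y - x) by ring, sin_pi_sub]
  have left : ∀ a, s + 2 ≤ a → a < n → sin (φ 1 - φ 0) - sin (φ 2 - φ 0) +
      sin (φ (2 + n) - φ a) - sin (φ (1 + n) - φ a) < 0 := fun a ha ha' => by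
    have k1 := hφ.monotone ha
    have k2 := hφ ha'
    have := sin_add_sin_lt (p := φ 1) (q := φ 2) (x := φ 0) (y := φ a) i12 (by linarith)
      (by rw [abs_lt]; constructor <;> linarith) (by rw [abs_lt]; constructor <;> linarith)
    rw [p1, p2, flip_sin, flip_sin, ← neg_sub (φ 2), ← neg_sub (φ 1) (φ a), sin_neg, sin_neg]
    linarith
  have right : ∀ y, φ (s + 2) < y → y ≤ φ n → sin (φ (s + 2) - φ (s + 1)) -
      sin (φ (s + 2) - φ s) + sin (y - φ s) - sin (y - φ (s + 1)) < 0 := fun y hy hy' => by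
    have := sin_add_sin_lt (p := φ s) (q := φ (s + 1)) (x := φ (s + 2)) (y := y - π) j1
      (by linarith) (by rw [abs_lt]; constructor <;> linarith)
      (by rw [abs_lt]; constructor <;> linarith)
    rw [show φ s - (y - π) = φ s + π - y by ring, flip_sin,
      show φ (s + 1) - (y - π) = φ (s + 1) + π - y by ring, flip_sin, ← neg_sub (φ (s + 2)),
      ← neg_sub (φ (s + 2)), sin_neg, sin_neg] at this
    linarith
  have last_lt : s + 2 ≤ lastSel w n → lastSel w n < n := fun _ => by
    refine (lastSel_le n).lt_of_ne fun h => ?_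
    have := lastSel_sel h0 n
    rw [h, wn] at this
    cases this
  rcases hws : w (s + 2) with _ | _
  · rw [hws] at ws2' wn2 wn2' hend
    simp only [hend, Bool.false_eq_true, if_false] at hl
    obtain ⟨l1, l2, l3, l4⟩ := hl
    simp only [Bool.not_false] at wn2 wn2'
    obtain ⟨-, f⟩ := sweep_sub_of_lastSel_eq (φ := φ) _ _ ag2
      (by rw [lastSel_of_true wn2, lastSel_of_true wn2'])
    rw [e2, sweep_succ_of_true wn2, sweep_succ_of_true wn2', l3, l4, ps, ps1,
      show n + s + 1 + 1 = s + 2 + n by ring, ps2, add_sub_add_right_eq_sub,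
      add_sub_add_right_eq_sub] at f
    have g := sweep_of_agree (φ := φ) _ _ ag1
    rw [e1, show s + 2 = s + 1 + 1 by ring, lastSel_succ_of_false hws,
      lastSel_succ_of_false ws2', sweep_succ_of_false hws, sweep_succ_of_false ws2', l1, l2] at g
    rcases g with ⟨g1, g2, g3, g4, -⟩ | ⟨b, a, g1, g2, g3, g4, g5, g6⟩
    · have := sin_add_sin_add_sin_lt (a := φ 1 - φ 0) (b := φ 2 - φ 1) (c := φ s - φ 2)
        (d := φ (s + 1) - φ s) (e := φ (s + 2) - φ (s + 1)) (by linarith) (by linarith)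
        (by linarith) (by linarith) (by linarith) (by linarith) (by linarith)
      rw [g1, g2, p1, p2, flip_sin, flip_sin] at hsw
      ring_nf at this hsw f g3 g4 ⊢
      linarith
    · have r := right (φ b) (hφ (by omega)) (hφ.monotone (by omega))
      have l := left a (by omega) (by rw [← g4]; exact last_lt (by omega))
      rw [g4, g5] at hsw
      linarith
  · rw [hws] at ws2' wn2 wn2' hend
    simp only [hend, if_true] at hl
    obtain ⟨l1, l2, l3, l4⟩ := hl
    simp only [Bool.not_true] at wn2 wn2'
    obtain ⟨f1, f⟩ := sweep_sub_of_lastSel_eq (φ := φ) _ _ ag1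
      (by rw [lastSel_of_true hws, lastSel_of_true ws2'])
    rw [e1, show s + 2 = s + 1 + 1 by ring, sweep_succ_of_true hws, sweep_succ_of_true ws2',
      l1, l2] at f
    rw [e1] at f1
    have k : s + 2 ≤ lastSel w n := by
      rw [← lastSel_of_true hws]
      exact lastSel_mono (by omega)
    have l := left _ k (last_lt k)
    have g := sweep_of_agree (φ := φ) _ _ ag2
    rw [e2, lastSel_succ_of_false wn2,
      lastSel_succ_of_false wn2', sweep_succ_of_false wn2, sweep_succ_of_false wn2', l3, l4] at g
    rcases g with ⟨-, -, -, -, g⟩ | ⟨b, a, g1, g2, g3, g4, g5, g6⟩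
    · rw [g _ (by omega) le_rfl] at w2n
      cases w2n
    · obtain ⟨b, rfl⟩ := Nat.exists_eq_add_of_le' (show n ≤ b by omega)
      have r := right (φ b) (hφ (by omega)) (hφ.monotone (by omega))
      rw [ps, ps1, hper, add_sub_add_right_eq_sub, add_sub_add_right_eq_sub] at g6
      rw [← f1] at hsw
      simp only [show s + 1 + 1 = s + 2 by ring] at f
      linarith

end Selection


/-- Twice the signed area of the triangle `p q r`. -/
def orient (p q r : ℝ × ℝ) : ℝ := (q.1 - p.1) * (r.2 - p.2) - (q.2 - p.2) * (r.1 - p.1)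

lemma orient_combination (p q x y : ℝ × ℝ) {a b : ℝ} (hab : a + b = 1) :
    orient p q (a • x + b • y) = a * orient p q x + b * orient p q y := by
  obtain rfl : b = 1 - a := by linarith
  simp only [orient, Prod.fst_add, Prod.snd_add, Prod.smul_fst, Prod.smul_snd, smul_eq_mul]
  ring

lemma convex_orient_nonneg (p q : ℝ × ℝ) : Convex ℝ {x | 0 ≤ orient p q x} := by
  intro x hx y hy a b ha hb hab
  simp only [Set.mem_ofPred_eq] at *
  rw [orient_combination _ _ _ _ hab]
  positivity

lemma orient_swap (p q x : ℝ × ℝ) : orient q p x = -orient p q x := by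
  simp only [orient]; ring

lemma orient_nonneg_of_mem_convexHull {p q x : ℝ × ℝ} {s : Set (ℝ × ℝ)}
    (h : ∀ y ∈ s, 0 ≤ orient p q y) (hx : x ∈ convexHull ℝ s) : 0 ≤ orient p q x :=
  convexHull_min h (convex_orient_nonneg p q) hx

lemma Convex.combination_three_mem {s : Set (ℝ × ℝ)} (hs : Convex ℝ s) {x y z : ℝ × ℝ}
    (hx : x ∈ s) (hy : y ∈ s) (hz : z ∈ s) {a b c : ℝ} (ha : 0 ≤ a) (hb : 0 ≤ b) (hc : 0 ≤ c)
    (h : a + b + c = 1) : a • x + b • y + c • z ∈ s := by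
  have := hs.sum_mem (t := Finset.univ) (w := ![a, b, c]) (z := ![x, y, z])
    (by simp [Fin.forall_fin_succ, ha, hb, hc]) (by simp [Fin.sum_univ_three, h])
    (by simp [Fin.forall_fin_succ, hx, hy, hz])
  simpa [Fin.sum_univ_three] using this

lemma mem_convexHull_triple {p q r x : ℝ × ℝ} :
    x ∈ convexHull ℝ {p, q, r} ↔
      ∃ a b c : ℝ, 0 ≤ a ∧ 0 ≤ b ∧ 0 ≤ c ∧ a + b + c = 1 ∧ x = a • p + b • q + c • r := by
  constructor
  · rw [← convexJoin_singleton_segment, mem_convexJoin]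
    rintro ⟨_, rfl, y, ⟨b, c, hb, hc, hbc, rfl⟩, a, d, ha, hd, had, rfl⟩
    refine ⟨a, d * b, d * c, ha, by positivity, by positivity, ?_, ?_⟩
    · linear_combination had + d * hbc
    · module
  · rintro ⟨a, b, c, ha, hb, hc, h, rfl⟩
    exact (convex_convexHull ℝ _).combination_three_mem (subset_convexHull ℝ _ (by simp))
      (subset_convexHull ℝ _ (by simp)) (subset_convexHull ℝ _ (by simp)) ha hb hc h

lemma volume_standard_triangle :
    volume {x : ℝ × ℝ | 0 ≤ x.1 ∧ 0 ≤ x.2 ∧ x.1 + x.2 ≤ 1} = ENNReal.ofReal (1 / 2) := by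
  have hm : MeasurableSet {x : ℝ × ℝ | 0 ≤ x.1 ∧ 0 ≤ x.2 ∧ x.1 + x.2 ≤ 1} := by
    measurability
  rw [Measure.volume_eq_prod, Measure.prod_apply hm]
  have : ∀ x : ℝ, volume (Prod.mk x ⁻¹' {x : ℝ × ℝ | 0 ≤ x.1 ∧ 0 ≤ x.2 ∧ x.1 + x.2 ≤ 1}) =
      (Set.Icc (0 : ℝ) 1).indicator (fun x => ENNReal.ofReal (1 - x)) x := by
    intro x
    by_cases hx : x ∈ Set.Icc (0 : ℝ) 1
    · rw [Set.indicator_of_mem hx, ← sub_zero (1 - x), ← Real.volume_Icc]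
      congr 1
      ext y
      simp only [Set.mem_preimage, Set.mem_ofPred_eq, Set.mem_Icc]
      exact ⟨fun h => ⟨h.2.1, by linarith⟩, fun h => ⟨hx.1, h.1, by linarith⟩⟩
    · rw [Set.indicator_of_notMem hx]
      convert measure_empty (μ := (volume : Measure ℝ))
      ext y
      simp only [Set.mem_preimage, Set.mem_ofPred_eq, Set.mem_empty_iff_false, iff_false]
      exact fun h => hx ⟨h.1, by linarith⟩
  simp_rw [this]
  rw [lintegral_indicator measurableSet_Icc, ← ofReal_integral_eq_lintegral_ofReal]
  · rw [integral_Icc_eq_integral_Ioc, ← intervalIntegral.integral_of_le zero_le_one,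
      intervalIntegral.integral_sub (by simp) (by simp)]
    norm_num
  · exact (Continuous.integrableOn_Icc (by fun_prop))
  · rw [Filter.EventuallyLE, ae_restrict_iff' measurableSet_Icc]
    exact Filter.Eventually.of_forall fun x hx => by simpa using hx.2

lemma volume_triangle (p q r : ℝ × ℝ) :
    volume (convexHull ℝ {p, q, r}) = ENNReal.ofReal (|orient p q r| / 2) := by
  let L : ℝ × ℝ →ₗ[ℝ] ℝ × ℝ := Matrix.toLin (Module.Basis.finTwoProd ℝ) (Module.Basis.finTwoProd ℝ)
    !![q.1 - p.1, r.1 - p.1; q.2 - p.2, r.2 - p.2]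
  have hL : ∀ x, L x = x.1 • (q - p) + x.2 • (r - p) := fun x => by
    simp only [L, Matrix.toLin_finTwoProd_apply]
    ext <;> simp <;> ring
  have hdet : LinearMap.det L = orient p q r := by
    simp only [L, LinearMap.det_toLin, Matrix.det_fin_two_of, orient]; ring
  have : convexHull ℝ {p, q, r} =
      (fun x => p + x) '' (L '' {x : ℝ × ℝ | 0 ≤ x.1 ∧ 0 ≤ x.2 ∧ x.1 + x.2 ≤ 1}) := by
    ext x
    rw [mem_convexHull_triple]
    constructor
    · rintro ⟨a, b, c, ha, hb, hc, h, rfl⟩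
      refine ⟨_, ⟨(b, c), ⟨hb, hc, by dsimp only; linarith⟩, rfl⟩, ?_⟩
      obtain rfl : a = 1 - b - c := by linarith
      simp only [hL]
      module
    · rintro ⟨_, ⟨y, ⟨h1, h2, h3⟩, rfl⟩, rfl⟩
      refine ⟨1 - y.1 - y.2, y.1, y.2, by linarith, h1, h2, by ring, ?_⟩
      simp only [hL]
      module
  rw [this, Set.image_add_left, measure_preimage_add, Measure.addHaar_image_linearMap, hdet,
    volume_standard_triangle, ← ENNReal.ofReal_mul (abs_nonneg _)]
  ring_nf

lemma volume_setOf_orient_eq_zero {p q : ℝ × ℝ} (h : p ≠ q) :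
    volume {x | orient p q x = 0} = 0 := by
  let f : ℝ × ℝ →ₗ[ℝ] ℝ :=
    (q.1 - p.1) • LinearMap.snd ℝ ℝ ℝ - (q.2 - p.2) • LinearMap.fst ℝ ℝ ℝ
  have hf : ∀ x, f (x - p) = orient p q x := fun x => by simp [f, orient]
  have hs : {x | orient p q x = 0} = (AffineSubspace.mk' p (LinearMap.ker f) : Set (ℝ × ℝ)) := by
    ext x
    simp [AffineSubspace.mem_mk', ← hf]
  rw [hs]
  refine Measure.addHaar_affineSubspace _ _ fun htop => h ?_
  have : p + (-(q.2 - p.2), q.1 - p.1) ∈ AffineSubspace.mk' p (LinearMap.ker f) := by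
    rw [htop]; trivial
  rw [AffineSubspace.mem_mk'] at this
  simp [f] at this
  ext <;> nlinarith [sq_nonneg (q.1 - p.1), sq_nonneg (q.2 - p.2)]

lemma convexHull_insert_eq_union {s : Set (ℝ × ℝ)} {p q r : ℝ × ℝ} (hp : p ∈ s) (hq : q ∈ s)
    (hqr : ∀ y ∈ s, 0 ≤ orient q r y) (hrp : ∀ y ∈ s, 0 ≤ orient r p y)
    (hpos : 0 < orient p q r) :
    convexHull ℝ (insert r s) = convexHull ℝ s ∪ convexHull ℝ {p, q, r} := by
  apply Set.Subset.antisymm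
  · rw [convexHull_insert ⟨p, hp⟩]
    intro x hx
    rw [mem_convexJoin] at hx
    obtain ⟨_, rfl, y, hy, a, b, ha, hb, hab, rfl⟩ := hx
    rename_i r
    have h2 := orient_nonneg_of_mem_convexHull hrp hy
    have h3 := orient_nonneg_of_mem_convexHull hqr hy
    have hsum : orient p q y + orient q r y + orient r p y = orient p q r := by
      simp only [orient]; ring
    have hbary : orient p q r • y =
        orient q r y • p + orient r p y • q + orient p q y • r := by
      ext <;> simp [orient] <;> ring
    generalize orient p q r = D at *
    generalize orient p q y = o₁ at *
    generalize orient q r y = o₃ at *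
    generalize orient r p y = o₂ at *
    rcases le_or_gt 0 (a * D + b * o₁) with h | h
    · right
      rw [mem_convexHull_triple]
      refine ⟨b * o₃ / D, b * o₂ / D, (a * D + b * o₁) / D, by positivity, by positivity,
        by positivity, ?_, ?_⟩
      · field_simp
        linear_combination b * hsum + D * hab
      · have hy' : y = D⁻¹ • (o₃ • p + o₂ • q + o₁ • r) := by
          rw [← hbary, smul_smul, inv_mul_cancel₀ hpos.ne', one_smul]
        rw [hy']
        match_scalars <;> field_simp
    · left
      have ho : o₁ < 0 := by
        by_contra hcon
        have : 0 ≤ a * D + b * o₁ := by have := not_lt.1 hcon; positivity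
        linarith
      have hr : r = (-o₁)⁻¹ • (o₃ • p + o₂ • q - D • y) := by
        rw [hbary, show o₃ • p + o₂ • q - (o₃ • p + o₂ • q + o₁ • r) = (-o₁) • r by module,
          smul_smul, inv_mul_cancel₀ (by linarith), one_smul]
      have ho' : 0 < -o₁ := by linarith
      have ho'' := ho.ne
      have e : a • r + b • y = (a * o₃ / -o₁) • p + (a * o₂ / -o₁) • q +
          (-(a * D + b * o₁) / -o₁) • y := by
        nth_rw 1 [hr]
        match_scalars <;> field_simp
      rw [e]
      refine (convex_convexHull ℝ s).combination_three_mem (subset_convexHull ℝ _ hp)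
        (subset_convexHull ℝ _ hq) hy (by positivity) (by positivity)
        (div_nonneg (by linarith) ho'.le) ?_
      rw [← add_div, ← add_div, div_eq_one_iff_eq ho'.ne']
      linear_combination a * hsum - o₁ * hab
  · refine Set.union_subset (convexHull_mono (Set.subset_insert _ _)) (convexHull_mono ?_)
    rintro x (rfl | rfl | rfl)
    · exact Or.inr hp
    · exact Or.inr hq
    · exact Or.inl rfl

lemma volume_convexHull_insert {s : Set (ℝ × ℝ)} {p q r : ℝ × ℝ}
    (hp : p ∈ s) (hq : q ∈ s) (hpq : ∀ y ∈ s, orient p q y ≤ 0)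
    (hqr : ∀ y ∈ s, 0 ≤ orient q r y) (hrp : ∀ y ∈ s, 0 ≤ orient r p y)
    (hpos : 0 < orient p q r) :
    volume (convexHull ℝ (insert r s)) =
      volume (convexHull ℝ s) + ENNReal.ofReal (orient p q r / 2) := by
  have hne : p ≠ q := by
    rintro rfl
    simp [orient] at hpos
  have hnull : volume (convexHull ℝ s ∩ convexHull ℝ {p, q, r}) = 0 := by
    refine measure_mono_null ?_ (volume_setOf_orient_eq_zero hne)
    rintro x ⟨hx, hx'⟩
    have h1 : 0 ≤ orient q p x := orient_nonneg_of_mem_convexHull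
      (fun y hy => by rw [orient_swap]; linarith [hpq y hy]) hx
    have h2 : 0 ≤ orient p q x := orient_nonneg_of_mem_convexHull
      (by rintro y (rfl | rfl | rfl)
          · simp [orient]
          · simp [orient, mul_comm]
          · exact hpos.le) hx'
    rw [orient_swap] at h1
    exact le_antisymm (by linarith) h2
  rw [convexHull_insert_eq_union hp hq hqr hrp hpos,
    measure_union₀ ((convex_convexHull ℝ _).nullMeasurableSet volume) hnull, volume_triangle,
    abs_of_pos hpos]

lemma orient_pt_eq_sin (α β γ : ℝ) :
    orient (pt α) (pt β) (pt γ) = sin (β - α) + sin (γ - β) + sin (α - γ) := by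
  simp only [orient, pt, sin_sub]; ring

lemma orient_pt (α β γ : ℝ) :
    orient (pt α) (pt β) (pt γ) =
      4 * sin ((β - α) / 2) * sin ((γ - β) / 2) * sin ((γ - α) / 2) := by
  have e1 : sin (β - α) + sin (γ - β) = 2 * sin ((γ - α) / 2) * cos ((β - α) / 2 - (γ - β) / 2) := by
    rw [show β - α = (γ - α) / 2 + ((β - α) / 2 - (γ - β) / 2) by ring,
      show γ - β = (γ - α) / 2 - ((β - α) / 2 - (γ - β) / 2) by ring, sin_sub, sin_add]
    ring_nf
  have e2 : sin (α - γ) = -(2 * sin ((γ - α) / 2) * cos ((β - α) / 2 + (γ - β) / 2)) := by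
    rw [← neg_sub γ α, sin_neg, ← add_div, show β - α + (γ - β) = γ - α by ring, ← sin_two_mul]
    ring_nf
  rw [orient_pt_eq_sin, e1, e2, cos_sub, cos_add]
  ring

lemma volume_convexHull_pt_step {f : ℕ → ℝ} (hf : Monotone f) {k : ℕ}
    (hk : f (k + 1) ≤ f 0 + 2 * π) :
    0 ≤ orient (pt (f 0)) (pt (f k)) (pt (f (k + 1))) ∧
    volume (convexHull ℝ ((fun i => pt (f i)) '' Set.Iic (k + 1))) =
      volume (convexHull ℝ ((fun i => pt (f i)) '' Set.Iic k)) +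
        ENNReal.ofReal (orient (pt (f 0)) (pt (f k)) (pt (f (k + 1))) / 2) := by
  have nn : ∀ x y : ℝ, x ≤ y → y ≤ x + 2 * π → 0 ≤ sin ((y - x) / 2) := fun x y h h' =>
    sin_nonneg_of_nonneg_of_le_pi (by linarith) (by linarith)
  have np : ∀ x y : ℝ, x ≤ y → y ≤ x + 2 * π → sin ((x - y) / 2) ≤ 0 := fun x y h h' => by
    rw [← neg_sub, neg_div, sin_neg]; linarith [nn x y h h']
  have h0k := hf (Nat.zero_le k)
  have hk1 := hf (Nat.le_succ k)
  have hins : (fun i => pt (f i)) '' Set.Iic (k + 1) =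
      insert (pt (f (k + 1))) ((fun i => pt (f i)) '' Set.Iic k) := by
    rw [← Set.image_insert_eq (f := fun i => pt (f i))]
    congr 1
    ext i
    simp only [Set.mem_Iic, Set.mem_insert_iff]
    omega
  have m0 : pt (f 0) ∈ (fun i => pt (f i)) '' Set.Iic k := ⟨0, Nat.zero_le k, rfl⟩
  have mk : pt (f k) ∈ (fun i => pt (f i)) '' Set.Iic k := ⟨k, Set.self_mem_Iic, rfl⟩
  rw [hins]
  refine ⟨?_, ?_⟩
  · rw [orient_pt]
    have := nn (f 0) (f k) h0k (by linarith)
    have := nn (f k) (f (k + 1)) hk1 (by linarith)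
    have := nn (f 0) (f (k + 1)) (by linarith) (by linarith)
    positivity
  rcases hk1.eq_or_lt with h1 | h1
  · rw [← h1, Set.insert_eq_of_mem mk]
    simp [orient, mul_comm]
  rcases hk.eq_or_lt with h2 | h2
  · have : pt (f (k + 1)) = pt (f 0) := by simp [h2, pt]
    rw [this, Set.insert_eq_of_mem m0]
    simp [orient]
  rcases h0k.eq_or_lt with h3 | h3
  · have hs : (fun i => pt (f i)) '' Set.Iic k = {pt (f 0)} := by
      refine Set.eq_singleton_iff_unique_mem.2 ⟨m0, ?_⟩
      rintro _ ⟨i, hi, rfl⟩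
      have : f i = f 0 := le_antisymm (h3 ▸ hf hi) (hf (Nat.zero_le i))
      simp [this]
    have := volume_triangle (pt (f (k + 1))) (pt (f 0)) (pt (f 0))
    rw [Set.pair_eq_singleton] at this
    rw [hs, this, ← h3]
    simp [orient, mul_comm]
  · apply volume_convexHull_insert m0 mk
    · rintro _ ⟨i, hi, rfl⟩
      have i1 := hf (Nat.zero_le i)
      have i2 := hf (Set.mem_Iic.1 hi)
      rw [orient_pt]
      have a := nn (f 0) (f k) h0k (by linarith)
      have b := np (f i) (f k) i2 (by linarith)
      have c := nn (f 0) (f i) i1 (by linarith)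
      exact mul_nonpos_of_nonpos_of_nonneg
        (mul_nonpos_of_nonneg_of_nonpos (by positivity) b) c
    · rintro _ ⟨i, hi, rfl⟩
      have i1 := hf (Nat.zero_le i)
      have i2 := hf (Set.mem_Iic.1 hi)
      rw [orient_pt]
      have a := nn (f k) (f (k + 1)) hk1 (by linarith)
      have b := np (f i) (f (k + 1)) (by linarith) (by linarith)
      have c := np (f i) (f k) i2 (by linarith)
      exact mul_nonneg_of_nonpos_of_nonpos
        (mul_nonpos_of_nonneg_of_nonpos (by positivity) b) c
    · rintro _ ⟨i, hi, rfl⟩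
      have i1 := hf (Nat.zero_le i)
      have i2 := hf (Set.mem_Iic.1 hi)
      rw [orient_pt]
      have a := np (f 0) (f (k + 1)) (by linarith) (by linarith)
      have b := nn (f 0) (f i) i1 (by linarith)
      have c := np (f i) (f (k + 1)) (by linarith) (by linarith)
      exact mul_nonneg_of_nonpos_of_nonpos
        (mul_nonpos_of_nonpos_of_nonneg (by linarith) b) c
    · have pos : ∀ x y : ℝ, x < y → y < x + 2 * π → 0 < sin ((y - x) / 2) := fun x y h h' =>
        sin_pos_of_pos_of_lt_pi (by linarith) (by linarith)
      rw [orient_pt]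
      have := pos (f 0) (f k) h3 (by linarith)
      have := pos (f k) (f (k + 1)) h1 (by linarith)
      have := pos (f 0) (f (k + 1)) (by linarith) (by linarith)
      positivity

/-- The shoelace formula for points in circular order on the unit circle. -/
lemma volume_convexHull_pt {f : ℕ → ℝ} (hf : Monotone f) (k : ℕ) (hk : f k ≤ f 0 + 2 * π) :
    0 ≤ ∑ i ∈ Finset.range k, sin (f (i + 1) - f i) + sin (f 0 - f k) ∧
    volume (convexHull ℝ ((fun i => pt (f i)) '' Set.Iic k)) =
      ENNReal.ofReal ((∑ i ∈ Finset.range k, sin (f (i + 1) - f i) + sin (f 0 - f k)) / 2) := by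
  induction k with
  | zero =>
    have : Set.Iic 0 = ({0} : Set ℕ) := by ext; simp
    simp [this]
  | succ k ih =>
    obtain ⟨ih1, ih2⟩ := ih ((hf (Nat.le_succ k)).trans hk)
    obtain ⟨h1, h2⟩ := volume_convexHull_pt_step hf hk
    have e : ∑ i ∈ Finset.range (k + 1), sin (f (i + 1) - f i) + sin (f 0 - f (k + 1)) =
        ∑ i ∈ Finset.range k, sin (f (i + 1) - f i) + sin (f 0 - f k) +
          orient (pt (f 0)) (pt (f k)) (pt (f (k + 1))) := by
      rw [Finset.sum_range_succ, orient_pt_eq_sin, ← neg_sub (f k) (f 0), sin_neg]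
      ring
    rw [e, h2, ih2, ← ENNReal.ofReal_add (by positivity) (by positivity), ← add_div]
    exact ⟨by positivity, rfl⟩

section Configuration

variable {n : ℕ}

/-- The angles of the points of an antipodal point set, listed in circular order and continued
periodically. -/
noncomputable def angle (hn : 0 < n) (θ : Fin n → ℝ) (k : ℕ) : ℝ :=
  θ ⟨k % n, Nat.mod_lt k hn⟩ + π * (k / n : ℕ)

lemma angle_add (hn : 0 < n) (θ : Fin n → ℝ) (k : ℕ) :
    angle hn θ (k + n) = angle hn θ k + π := by
  simp only [angle, Nat.add_mod_right, Nat.add_div_right _ hn]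
  push_cast
  ring

lemma angle_strictMono (hn : 0 < n) {θ : Fin n → ℝ} (hmono : StrictMono θ)
    (hrange : ∀ i, θ i ∈ Set.Ico 0 π) : StrictMono (angle hn θ) := by
  refine strictMono_nat_of_lt_succ fun k => ?_
  simp only [angle]
  by_cases h : n ∣ k + 1
  · have h1 := (hrange ⟨k % n, Nat.mod_lt k hn⟩).2
    have h2 := (hrange ⟨(k + 1) % n, Nat.mod_lt _ hn⟩).1
    rw [Nat.succ_div_of_dvd h]
    push_cast
    linarith
  · rw [Nat.succ_div_of_not_dvd h]
    refine add_lt_add_left (hmono ?_) _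
    rw [Fin.mk_lt_mk]
    have h1 := Nat.div_add_mod k n
    have h2 := Nat.div_add_mod (k + 1) n
    rw [Nat.succ_div_of_not_dvd h] at h2
    omega

lemma chosen_eq (hn : 0 < n) (ε : Fin n → Bool) (k : ℕ) :
    chosen ε k = (ε ⟨k % n, Nat.mod_lt k hn⟩ ^^ decide (k / n % 2 = 1)) := by
  have h1 : k % (2 * n) = k % n + n * (k / n % 2) := by rw [mul_comm 2 n, Nat.mod_mul]
  have h2 := Nat.mod_lt k hn
  rcases Nat.mod_two_eq_zero_or_one (k / n) with h | h
  · rw [h, mul_zero, add_zero] at h1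
    simp [chosen, h1, h2, h]
  · rw [h, mul_one] at h1
    simp [chosen, h1, h2, h]

lemma chosen_add (hn : 0 < n) (ε : Fin n → Bool) (k : ℕ) :
    chosen ε (k + n) = !chosen ε k := by
  rw [chosen_eq hn, chosen_eq hn]
  simp only [Nat.add_mod_right, Nat.add_div_right _ hn]
  rcases Nat.mod_two_eq_zero_or_one (k / n) with h | h
  · have : (k / n).succ % 2 = 1 := by omega
    simp [h, this]
  · have : (k / n).succ % 2 = 0 := by omega
    simp [h, this]

lemma pt_add_pi (α : ℝ) : pt (α + π) = -pt α := by simp [pt]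

lemma pt_angle_of_chosen (hn : 0 < n) (θ : Fin n → ℝ) {ε : Fin n → Bool} {k : ℕ}
    (h : chosen ε k = true) : pt (angle hn θ k) = vtx θ ε ⟨k % n, Nat.mod_lt k hn⟩ := by
  have key : ∀ (α : ℝ) (q : ℕ), pt (α + π * q) = if q % 2 = 1 then -pt α else pt α := by
    intro α q
    induction q with
    | zero => simp
    | succ q ih =>
      rw [show α + π * (q + 1 : ℕ) = α + π * q + π by push_cast; ring, pt_add_pi, ih]
      rcases Nat.mod_two_eq_zero_or_one q with h | h
      · have : (q + 1) % 2 = 1 := by omega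
        simp [h, this]
      · have : (q + 1) % 2 = 0 := by omega
        simp [h, this]
  rw [chosen_eq hn] at h
  rw [angle, key, vtx]
  by_cases hq : k / n % 2 = 1 <;> simp_all

lemma exists_add_mod_eq (hn : 0 < n) (j : ℕ) (i : Fin n) : ∃ t < n, (j + t) % n = i := by
  have hj := Nat.mod_lt j hn
  rcases le_or_gt (j % n) i with h | h
  · refine ⟨i - j % n, by omega, ?_⟩
    rw [Nat.add_mod, Nat.mod_eq_of_lt (show i - j % n < n by omega),
      Nat.add_sub_cancel' h, Nat.mod_eq_of_lt i.2]
  · refine ⟨i + n - j % n, by omega, ?_⟩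
    rw [Nat.add_mod, Nat.mod_eq_of_lt (show i + n - j % n < n by omega),
      Nat.add_sub_cancel' (by omega), Nat.add_mod_right, Nat.mod_eq_of_lt i.2]

/-- The vertices of an antipodal polygon, enumerated weakly monotonically. -/
lemma range_vtx_eq (hn : 0 < n) (θ : Fin n → ℝ) (ε : Fin n → Bool) (j : ℕ)
    (h0 : chosen ε j = true) :
    Set.range (vtx θ ε) =
      (fun t => pt (angle hn θ (j + lastSel (fun t => chosen ε (j + t)) t))) ''
        Set.Iic (2 * n) := by
  ext x
  constructor
  · rintro ⟨i, rfl⟩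
    obtain ⟨t, ht, hti⟩ := exists_add_mod_eq hn j i
    rcases h : chosen ε (j + t) with _ | _
    · have h' : chosen ε (j + (t + n)) = true := by rw [← add_assoc, chosen_add hn, h]; rfl
      refine ⟨t + n, by simp only [Set.mem_Iic]; omega, ?_⟩
      dsimp only
      rw [lastSel_of_true (w := fun t => chosen ε (j + t)) h', pt_angle_of_chosen hn θ h']
      congr 1
      ext
      simp [← add_assoc, hti]
    · refine ⟨t, by simp only [Set.mem_Iic]; omega, ?_⟩
      dsimp only
      rw [lastSel_of_true (w := fun t => chosen ε (j + t)) h, pt_angle_of_chosen hn θ h]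
      congr 1
      ext
      simp [hti]
  · rintro ⟨t, -, rfl⟩
    have := lastSel_sel (w := fun t => chosen ε (j + t)) h0 t
    exact ⟨_, (pt_angle_of_chosen hn θ this).symm⟩

lemma volume_apoly (hn : 0 < n) {θ : Fin n → ℝ} (hmono : StrictMono θ)
    (hrange : ∀ i, θ i ∈ Set.Ico 0 π) (ε : Fin n → Bool) (j : ℕ) (h0 : chosen ε j = true) :
    0 ≤ sweep (fun t => angle hn θ (j + t)) (fun t => chosen ε (j + t)) (2 * n) ∧
    volume (apoly θ ε) = ENNReal.ofReal
      (sweep (fun t => angle hn θ (j + t)) (fun t => chosen ε (j + t)) (2 * n) / 2) := by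
  have hs : lastSel (fun t => chosen ε (j + t)) (2 * n) = 2 * n := by
    apply lastSel_of_true
    rw [two_mul, ← add_assoc, chosen_add hn, chosen_add hn, h0]
    rfl
  have hp : angle hn θ (j + 2 * n) = angle hn θ j + 2 * π := by
    rw [two_mul, ← add_assoc, angle_add, angle_add]; ring
  have := volume_convexHull_pt
    (f := fun t => angle hn θ (j + lastSel (fun t => chosen ε (j + t)) t))
    (fun a b hab => (angle_strictMono hn hmono hrange).monotone
      (Nat.add_le_add_left (lastSel_mono hab) j)) (2 * n) (by rw [hs, hp]; rfl)
  rw [hs, hp] at this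
  simp only [lastSel, add_zero, sub_add_cancel_left, sin_neg, sin_two_pi, neg_zero] at this
  rw [apoly, range_vtx_eq hn θ ε j h0]
  exact this

end Configuration

/-- Flipping an alternating run: if P contains q₁ = point j and q₂, contains
either both or neither of q_{m-1}, q_m, and q₂, …, q_{m-1} alternate between
being vertices and not, then flipping q₂, …, q_{m-1} strictly increases the area. -/
theorem stmt_8 (n m : ℕ) (hm : 4 ≤ m) (hmn : m < n)
    (θ : Fin n → ℝ) (hmono : StrictMono θ)
    (hrange : ∀ i, θ i ∈ Set.Ico 0 Real.pi)
    (ε ε' : Fin n → Bool) (j : ℕ)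
    (h1 : chosen ε j = true) (h2 : chosen ε (j + 1) = true)
    (hend : chosen ε (j + (m - 2)) = chosen ε (j + (m - 1)))
    (halt : ∀ t, 1 ≤ t → t + 1 ≤ m - 2 → chosen ε (j + t) ≠ chosen ε (j + t + 1))
    (hflip : ∀ t, 1 ≤ t → t ≤ m - 2 → ∀ i : Fin n, i.val = (j + t) % n → ε' i = !(ε i))
    (hkeep : ∀ i : Fin n, (∀ t, 1 ≤ t → t ≤ m - 2 → i.val ≠ (j + t) % n) → ε' i = ε i) :
    volume (apoly θ ε) < volume (apoly θ ε') := by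
  have hn : 0 < n := by omega
  have keep : ∀ t < n, t = 0 ∨ m - 1 ≤ t → chosen ε' (j + t) = chosen ε (j + t) := by
    intro t ht h
    rw [chosen_eq hn, chosen_eq hn, hkeep]
    intro u hu hu' heq
    have : t ≡ u [MOD n] := Nat.ModEq.add_left_cancel' j heq
    have := this.eq_of_lt_of_lt ht (by omega)
    omega
  have flip : ∀ t, 1 ≤ t → t ≤ m - 2 → chosen ε' (j + t) = !chosen ε (j + t) := by
    intro t h h'
    rw [chosen_eq hn, chosen_eq hn, hflip t h h' _ rfl, Bool.not_xor]
  have h1' : chosen ε' j = true := (keep 0 hn (Or.inl rfl)).trans h1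
  obtain ⟨hnn, hv⟩ := volume_apoly hn hmono hrange ε j h1
  obtain ⟨-, hv'⟩ := volume_apoly hn hmono hrange ε' j h1'
  have := sweep_lt_sweep (φ := fun t => angle hn θ (j + t)) (w := fun t => chosen ε (j + t))
    (w' := fun t => chosen ε' (j + t)) (n := n)
    (fun a b hab => angle_strictMono hn hmono hrange (Nat.add_lt_add_left hab j))
    (fun t => by rw [← add_assoc, angle_add]) (fun t => by rw [← add_assoc, chosen_add hn])
    (fun t => by rw [← add_assoc, chosen_add hn]) h1 h2 (m - 3) (by omega) (by omega)
    (by rwa [show m - 3 + 1 = m - 2 by omega, show m - 3 + 2 = m - 1 by omega])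
    (fun t h h' => halt t h (by omega)) (fun t h h' => flip t h (by omega))
    (fun t h h' => keep t h' (Or.inr (by omega))) (keep 0 hn (Or.inl rfl))
  rw [hv, hv', ENNReal.ofReal_lt_ofReal_iff_of_nonneg (by positivity)]
  linarith
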